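/- The patch counting entropy of the visible points equals (6/π²)·log 2: with N(ρ) denoting the number of distinct ρ-patches (V − t) ∩ B_ρ(0) as t ranges over ℤ², one has lim_{ρ→∞} log N(ρ)/(π ρ²) = (6/π²)·log 2. -/

import Mathlib

open Filter Topology

/-- The set of visible points of the square lattice `ℤ²`. -/
def Vis : Set (ℤ × ℤ) := {x | Int.gcd x.1 x.2 = 1}

/-- The number of distinct `ρ`-patches `(V − t) ∩ B_ρ(0)` of the visible points. -/
noncomputable def Npatch (ρ : ℝ) : ℕ :=
  Nat.card ↥(Set.range fun t : ℤ × ℤ =>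
    {y : ℤ × ℤ | y + t ∈ Vis ∧ (y.1 : ℝ)^2 + (y.2 : ℝ)^2 < ρ^2})

/-- Lattice points in the open ball of radius `r`. -/
noncomputable def ballF (r : ℝ) : Finset (ℤ × ℤ) :=
  (Finset.Icc (-⌈|r|⌉) ⌈|r|⌉ ×ˢ Finset.Icc (-⌈|r|⌉) ⌈|r|⌉).filter
    (fun y => (y.1 : ℝ)^2 + (y.2 : ℝ)^2 < r^2)

lemma mem_ballF {r : ℝ} {y : ℤ × ℤ} :
    y ∈ ballF r ↔ (y.1 : ℝ)^2 + (y.2 : ℝ)^2 < r^2 := by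
  unfold ballF
  rw [Finset.mem_filter, Finset.mem_product, Finset.mem_Icc, Finset.mem_Icc]
  refine ⟨fun h => h.2, fun h => ⟨?_, h⟩⟩
  have key : ∀ a : ℤ, (a : ℝ)^2 < r^2 → -⌈|r|⌉ ≤ a ∧ a ≤ ⌈|r|⌉ := by
    intro a ha
    have h1 : |(a : ℝ)| < |r| := sq_lt_sq.mp ha
    have h2 := Int.le_ceil |r|
    rw [abs_lt] at h1
    constructor
    · have : (-⌈|r|⌉ : ℝ) ≤ (a : ℝ) := by linarith
      exact_mod_cast this
    · have : (a : ℝ) ≤ (⌈|r|⌉ : ℝ) := by linarith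
      exact_mod_cast this
  exact ⟨key _ (by nlinarith [sq_nonneg (y.2 : ℝ)]), key _ (by nlinarith [sq_nonneg (y.1 : ℝ)])⟩

/-- The open unit disc in `Fin 2 → ℝ`. -/
def discS : Set (Fin 2 → ℝ) := (WithLp.toLp 2) ⁻¹' (Metric.ball (0 : EuclideanSpace ℝ (Fin 2)) 1)

lemma mem_discS (v : Fin 2 → ℝ) : v ∈ discS ↔ v 0 ^ 2 + v 1 ^ 2 < 1 := by
  unfold discS
  rw [Set.mem_preimage, mem_ball_zero_iff, EuclideanSpace.norm_eq, Real.sqrt_lt' one_pos]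
  simp

lemma convex_discS : Convex ℝ discS := by
  have := (convex_ball (0 : EuclideanSpace ℝ (Fin 2)) 1).linear_preimage
    (WithLp.linearEquiv 2 ℝ (Fin 2 → ℝ)).symm.toLinearMap
  exact this

open scoped Pointwise in
lemma gauss_circle :
    Tendsto (fun r : ℝ => ((ballF r).card : ℝ) / r ^ 2) atTop (𝓝 Real.pi) := by
  have hb : Bornology.IsBounded discS := by
    refine (Metric.isBounded_closedBall (x := (0 : Fin 2 → ℝ)) (r := 1)).subset fun v hv => ?_
    rw [mem_discS] at hv
    rw [mem_closedBall_zero_iff, pi_norm_le_iff_of_nonneg zero_le_one]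
    intro i
    rw [Real.norm_eq_abs, abs_le_one_iff_mul_self_le_one]
    fin_cases i <;> simp <;> nlinarith [sq_nonneg (v 0), sq_nonneg (v 1)]
  have hopen : IsOpen discS := by
    have : discS = {v : Fin 2 → ℝ | v 0 ^ 2 + v 1 ^ 2 < 1} := by
      ext v; exact mem_discS v
    rw [this]
    exact isOpen_lt (by fun_prop) (by fun_prop)
  have hvol : MeasureTheory.volume.real discS = Real.pi := by
    rw [MeasureTheory.measureReal_def]
    unfold discS
    rw [(PiLp.volume_preserving_toLp (Fin 2)).measure_preimage
      measurableSet_ball.nullMeasurableSet, EuclideanSpace.volume_ball_fin_two]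
    simp [Real.pi_nonneg]
  have h := tendsto_card_div_pow_atTop_volume' discS hb hopen.measurableSet
    (convex_discS.addHaar_frontier _) (by
      intro x y hx hxy v hv
      rw [Set.mem_smul_set_iff_inv_smul_mem₀ hx.ne'] at hv
      rw [Set.mem_smul_set_iff_inv_smul_mem₀ (hx.trans_le hxy).ne']
      rw [mem_discS] at *
      simp only [Pi.smul_apply, smul_eq_mul, mul_pow] at *
      refine lt_of_le_of_lt ?_ hv
      have hy : 0 < y := hx.trans_le hxy
      gcongr)
  rw [hvol] at h
  refine h.congr' ?_
  filter_upwards [eventually_gt_atTop 0] with x hx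
  simp only [Fintype.card_fin]
  congr 2
  have himg : (discS ∩ x⁻¹ • (Submodule.span ℤ (Set.range (Pi.basisFun ℝ (Fin 2))) : Set (Fin 2 → ℝ)))
      = (fun y : ℤ × ℤ => (![(y.1 : ℝ) / x, (y.2 : ℝ) / x] : Fin 2 → ℝ)) '' (ballF x) := by
    ext v
    rw [Set.mem_inter_iff, Set.mem_inv_smul_set_iff₀ hx.ne', SetLike.mem_coe,
      Module.Basis.mem_span_iff_repr_mem, mem_discS]
    simp only [Pi.basisFun_repr, Pi.smul_apply, smul_eq_mul, Set.mem_range, Set.mem_image,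
      Finset.mem_coe, mem_ballF, Prod.exists, Fin.forall_fin_two, algebraMap_int_eq, eq_intCast]
    constructor
    · rintro ⟨h1, ⟨a, ha⟩, ⟨b, hb⟩⟩
      refine ⟨a, b, ?_, ?_⟩
      · rw [ha, hb]; nlinarith [sq_pos_of_pos hx]
      · ext i; fin_cases i <;> simp [ha, hb, hx.ne']
    · rintro ⟨a, b, h1, rfl⟩
      refine ⟨?_, ⟨a, by simp; field_simp⟩, ⟨b, by simp; field_simp⟩⟩
      simp only [Matrix.cons_val_zero, Matrix.cons_val_one, div_pow]
      rw [← add_div, div_lt_one (by positivity)]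
      exact h1
  rw [himg, Nat.card_image_of_injective]
  · simp
  · intro a b hab
    have h0 := congrFun hab 0
    have h1 := congrFun hab 1
    simp [hx.ne'] at h0 h1
    exact Prod.ext h0 h1

lemma moebius_sum_div (n : ℕ) :
    ∑ d ∈ n.divisors, ((ArithmeticFunction.moebius d : ℤ) : ℝ) = if n = 1 then 1 else 0 := by
  have h := congrArg (fun f => f n) ArithmeticFunction.moebius_mul_coe_zeta
  simp only [ArithmeticFunction.coe_mul_zeta_apply, ArithmeticFunction.one_apply] at h
  have h2 := congrArg (Int.cast : ℤ → ℝ) h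
  push_cast at h2
  exact h2

lemma tsum_moebius :
    ∑' d : ℕ, ((ArithmeticFunction.moebius d : ℤ) : ℝ) / (d : ℝ) ^ 2 = 6 / Real.pi ^ 2 := by
  have h := ArithmeticFunction.LSeries_zeta_mul_Lseries_moebius (s := 2) (by simp)
  rw [ArithmeticFunction.LSeries_zeta_eq_riemannZeta (by simp), riemannZeta_two] at h
  have h2 : LSeries (fun n => ((ArithmeticFunction.moebius n : ℤ) : ℂ)) 2 =
      ((∑' d : ℕ, ((ArithmeticFunction.moebius d : ℤ) : ℝ) / (d : ℝ) ^ 2 : ℝ) : ℂ) := by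
    rw [LSeries, Complex.ofReal_tsum]
    refine tsum_congr fun n => ?_
    rw [LSeries.term_def]
    split_ifs with hn
    · simp [hn]
    · push_cast
      congr 1
      exact_mod_cast Complex.cpow_natCast (n : ℂ) 2
  rw [h2] at h
  have h3 : Real.pi ^ 2 / 6 *
      (∑' d : ℕ, ((ArithmeticFunction.moebius d : ℤ) : ℝ) / (d : ℝ) ^ 2) = 1 := by
    exact_mod_cast h
  have := Real.pi_pos
  field_simp
  field_simp at h3
  linarith

lemma abs_moebius_real_le (d : ℕ) : |((ArithmeticFunction.moebius d : ℤ) : ℝ)| ≤ 1 := by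
  exact_mod_cast ArithmeticFunction.abs_moebius_le_one (n := d)

/-- Points `y` of the ball with `y + t` divisible by `d`. -/
noncomputable def divF (ρ : ℝ) (d : ℕ) (t : ℤ × ℤ) : Finset (ℤ × ℤ) :=
  (ballF ρ).filter (fun y => (d : ℤ) ∣ y.1 + t.1 ∧ (d : ℤ) ∣ y.2 + t.2)

lemma shift_ineq {x y a b r T : ℝ} (hr : 0 ≤ r) (hT : |a| + |b| = T) (h : x ^ 2 + y ^ 2 < r ^ 2) :
    (x + a) ^ 2 + (y + b) ^ 2 < (r + T) ^ 2 := by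
  have hx : |x| ≤ r := abs_le_of_sq_le_sq (by nlinarith [sq_nonneg y]) hr
  have hy : |y| ≤ r := abs_le_of_sq_le_sq (by nlinarith [sq_nonneg x]) hr
  have h1 : x * a ≤ r * |a| := (le_abs_self _).trans (by rw [abs_mul]; gcongr)
  have h2 : y * b ≤ r * |b| := (le_abs_self _).trans (by rw [abs_mul]; gcongr)
  subst hT
  nlinarith [sq_abs a, sq_abs b, mul_nonneg (abs_nonneg a) (abs_nonneg b)]

lemma divF_le {ρ : ℝ} (hρ : 0 ≤ ρ) {d : ℕ} (hd : 0 < d) (t : ℤ × ℤ) :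
    (divF ρ d t).card ≤ (ballF ((ρ + (|(t.1 : ℝ)| + |(t.2 : ℝ)|)) / d)).card := by
  have hd' : (0 : ℝ) < d := by exact_mod_cast hd
  refine Finset.card_le_card_of_injOn (fun y => ((y.1 + t.1) / d, (y.2 + t.2) / d)) ?_ ?_
  · intro y hy
    simp only [divF, Finset.coe_filter, Set.mem_ofPred_eq, mem_ballF] at hy
    obtain ⟨h1, ⟨a, ha⟩, ⟨b, hb⟩⟩ := hy
    have hdz : (d : ℤ) ≠ 0 := by exact_mod_cast hd.ne'
    simp only [Finset.mem_coe, mem_ballF, ha, hb, Int.mul_ediv_cancel_left _ hdz]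
    have h2 := shift_ineq hρ (a := (t.1 : ℝ)) (b := (t.2 : ℝ)) rfl h1
    have ha' : (y.1 : ℝ) + t.1 = d * a := by exact_mod_cast ha
    have hb' : (y.2 : ℝ) + t.2 = d * b := by exact_mod_cast hb
    rw [ha', hb'] at h2
    rw [div_pow, lt_div_iff₀ (by positivity)]
    linarith
  · intro y hy z hz h
    simp only [divF, Finset.coe_filter, Set.mem_ofPred_eq, mem_ballF] at hy hz
    simp only [Prod.mk.injEq] at h
    have e1 := (Int.ediv_left_inj hy.2.1 hz.2.1).mp h.1
    have e2 := (Int.ediv_left_inj hy.2.2 hz.2.2).mp h.2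
    exact Prod.ext (by linarith) (by linarith)

lemma le_divF {ρ : ℝ} {d : ℕ} (hd : 0 < d) (t : ℤ × ℤ)
    (hρ : |(t.1 : ℝ)| + |(t.2 : ℝ)| ≤ ρ) :
    (ballF ((ρ - (|(t.1 : ℝ)| + |(t.2 : ℝ)|)) / d)).card ≤ (divF ρ d t).card := by
  have hd' : (0 : ℝ) < d := by exact_mod_cast hd
  have hdz : (d : ℤ) ≠ 0 := by exact_mod_cast hd.ne'
  refine Finset.card_le_card_of_injOn (fun y => (d * y.1 - t.1, d * y.2 - t.2)) ?_ ?_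
  · intro y hy
    simp only [Finset.mem_coe, mem_ballF] at hy
    rw [div_pow, lt_div_iff₀ (by positivity)] at hy
    simp only [divF, Finset.coe_filter, Set.mem_ofPred_eq, mem_ballF]
    refine ⟨?_, by simp, by simp⟩
    have h2 := shift_ineq (x := d * y.1) (y := d * y.2) (sub_nonneg.mpr hρ) (a := -(t.1 : ℝ))
      (b := -(t.2 : ℝ)) (T := |(t.1 : ℝ)| + |(t.2 : ℝ)|) (by simp) (by linarith)
    push_cast
    convert h2 using 2 <;> ring
  · intro y hy z hz h
    simp only [Prod.mk.injEq, sub_left_inj, mul_eq_mul_left_iff, hdz, or_false] at h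
    exact Prod.ext h.1 h.2

lemma divF_tendsto {d : ℕ} (hd : 0 < d) (t : ℤ × ℤ) :
    Tendsto (fun ρ : ℝ => ((divF ρ d t).card : ℝ) / ρ ^ 2) atTop (𝓝 (Real.pi / d ^ 2)) := by
  have hd' : (0 : ℝ) < d := by exact_mod_cast hd
  have key : ∀ c : ℝ, Tendsto (fun ρ : ℝ => ((ballF ((ρ + c) / d)).card : ℝ) / ρ ^ 2) atTop
      (𝓝 (Real.pi / d ^ 2)) := by
    intro c
    have hlin : Tendsto (fun ρ : ℝ => (ρ + c) / d) atTop atTop :=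
      (tendsto_atTop_add_const_right _ c tendsto_id).atTop_div_const hd'
    have h1 := gauss_circle.comp hlin
    have h2 : Tendsto (fun ρ : ℝ => (1 + c / ρ) / d) atTop (𝓝 ((1 + 0) / d)) :=
      ((tendsto_const_nhds.add (tendsto_const_nhds.div_atTop tendsto_id)).div_const _)
    have h3 := h1.mul (h2.pow 2)
    have e : Real.pi * ((1 + 0) / (d : ℝ)) ^ 2 = Real.pi / d ^ 2 := by
      field_simp; ring
    rw [e] at h3
    refine h3.congr' ?_
    filter_upwards [eventually_gt_atTop 0, eventually_gt_atTop (-c)] with ρ hρ hc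
    have : ρ + c ≠ 0 := by linarith
    simp only [Function.comp]
    field_simp
  refine tendsto_of_tendsto_of_tendsto_of_le_of_le'
    (key (-(|(t.1 : ℝ)| + |(t.2 : ℝ)|))) (key (|(t.1 : ℝ)| + |(t.2 : ℝ)|)) ?_ ?_
  · filter_upwards [eventually_ge_atTop (|(t.1 : ℝ)| + |(t.2 : ℝ)|)] with ρ hρ
    refine div_le_div_of_nonneg_right ?_ (sq_nonneg ρ)
    rw [← sub_eq_add_neg]
    exact Nat.cast_le.mpr (le_divF hd t hρ)
  · filter_upwards [eventually_ge_atTop 0] with ρ hρ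
    refine div_le_div_of_nonneg_right ?_ (sq_nonneg ρ)
    exact_mod_cast divF_le hρ hd t

lemma ballF_erase_card_le {r : ℝ} (hr : 0 ≤ r) :
    (((ballF r).erase 0).card : ℝ) ≤ 9 * r ^ 2 := by
  by_cases h1 : r ≤ 1
  · have : (ballF r).erase 0 = ∅ := by
      rw [Finset.eq_empty_iff_forall_notMem]
      intro y hy
      rw [Finset.mem_erase, mem_ballF] at hy
      apply hy.1
      have h2 : (y.1 : ℝ) ^ 2 + (y.2 : ℝ) ^ 2 < 1 := by nlinarith [hy.2]
      have h3 : y.1 ^ 2 + y.2 ^ 2 < 1 := by exact_mod_cast h2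
      have h4 : y.1 = 0 := by
        apply pow_eq_zero_iff (two_ne_zero) |>.mp; nlinarith [sq_nonneg y.1, sq_nonneg y.2]
      have h5 : y.2 = 0 := by
        apply pow_eq_zero_iff (two_ne_zero) |>.mp; nlinarith [sq_nonneg y.1, sq_nonneg y.2]
      exact Prod.ext h4 h5
    rw [this]; simp; positivity
  · push Not at h1
    set n := ⌊r⌋₊ with hn
    have hnr : (n : ℝ) ≤ r := Nat.floor_le hr
    have hn1 : 1 ≤ n := Nat.one_le_floor_iff _ |>.mpr h1.le
    have hsub : (ballF r).erase 0 ⊆ Finset.Icc (-(n : ℤ)) n ×ˢ Finset.Icc (-(n : ℤ)) n := by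
      intro y hy
      rw [Finset.mem_erase, mem_ballF] at hy
      have key : ∀ a : ℤ, (a : ℝ)^2 < r^2 → a ∈ Finset.Icc (-(n : ℤ)) n := by
        intro a ha
        have h1 : |(a : ℝ)| < r := by
          have := sq_lt_sq.mp ha
          rwa [abs_of_nonneg hr] at this
        have h2 : ((a.natAbs : ℕ) : ℝ) ≤ r := by
          rw [Nat.cast_natAbs, Int.cast_abs]; exact h1.le
        have h3 : a.natAbs ≤ n := Nat.le_floor h2
        rw [Finset.mem_Icc]; omega
      exact Finset.mem_product.mpr ⟨key _ (by nlinarith [sq_nonneg (y.2 : ℝ)]),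
        key _ (by nlinarith [sq_nonneg (y.1 : ℝ)])⟩
    have hc := Finset.card_le_card hsub
    rw [Finset.card_product, Int.card_Icc] at hc
    have e : ((n : ℤ) + 1 - -(n : ℤ)).toNat = 2 * n + 1 := by omega
    rw [e] at hc
    have hc' : (((ballF r).erase 0).card : ℝ) ≤ (2 * n + 1) * (2 * n + 1) := by exact_mod_cast hc
    have hn1' : (1 : ℝ) ≤ n := by exact_mod_cast hn1
    nlinarith

lemma divF_zero_erase_le {ρ : ℝ} (hρ : 0 ≤ ρ) (d : ℕ) :
    (((divF ρ d 0).erase 0).card : ℝ) ≤ 9 * ρ ^ 2 / d ^ 2 := by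
  rcases Nat.eq_zero_or_pos d with rfl | hd
  · have : (divF ρ 0 0).erase 0 = ∅ := by
      rw [Finset.eq_empty_iff_forall_notMem]
      intro y hy
      simp only [divF, Finset.mem_erase, Finset.mem_filter] at hy
      apply hy.1
      have h1 := hy.2.2.1
      have h2 := hy.2.2.2
      simp at h1 h2
      exact Prod.ext h1 h2
    rw [this]; simp
  · have hd' : (0 : ℝ) < d := by exact_mod_cast hd
    have h0 : ((divF ρ d 0).erase 0).card ≤ ((ballF (ρ / d)).erase 0).card := by
      by_cases hp : ρ = 0
      · have : divF ρ d 0 = ∅ := by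
          rw [Finset.eq_empty_iff_forall_notMem]
          intro y hy
          simp only [divF, Finset.mem_filter, mem_ballF, hp] at hy
          nlinarith [hy.1, sq_nonneg (y.1 : ℝ), sq_nonneg (y.2 : ℝ)]
        rw [this]; simp
      · have hpos : 0 < ρ := lt_of_le_of_ne hρ (Ne.symm hp)
        have h := divF_le hρ hd 0
        simp only [Prod.fst_zero, Prod.snd_zero, Int.cast_zero, abs_zero, add_zero] at h
        rw [Finset.card_erase_of_mem, Finset.card_erase_of_mem]
        · omega
        · rw [mem_ballF]; simp; positivity
        · simp only [divF, Finset.mem_filter, mem_ballF]; simp; positivity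
    have h1 := ballF_erase_card_le (r := ρ / d) (by positivity)
    calc (((divF ρ d 0).erase 0).card : ℝ) ≤ ((ballF (ρ / d)).erase 0).card := by exact_mod_cast h0
      _ ≤ _ := h1
      _ = _ := by rw [div_pow]; ring

lemma divF_zero_erase_tendsto (d : ℕ) :
    Tendsto (fun ρ : ℝ => (((divF ρ d 0).erase 0).card : ℝ) / ρ ^ 2) atTop
      (𝓝 (Real.pi / d ^ 2)) := by
  rcases Nat.eq_zero_or_pos d with rfl | hd
  · refine tendsto_const_nhds.congr' ?_
    filter_upwards [eventually_ge_atTop 0] with ρ hρ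
    have := divF_zero_erase_le hρ 0
    have h0 : (((divF ρ 0 0).erase 0).card : ℝ) = 0 :=
      le_antisymm (by simpa using this) (Nat.cast_nonneg _)
    rw [h0]; simp
  · have h1 := (divF_tendsto hd 0).sub
      (tendsto_const_nhds.div_atTop (tendsto_pow_atTop (two_ne_zero)) :
        Tendsto (fun ρ : ℝ => (1 : ℝ) / ρ ^ 2) atTop (𝓝 0))
    rw [sub_zero] at h1
    refine h1.congr' ?_
    filter_upwards [eventually_gt_atTop 0] with ρ hρ
    rw [Finset.cast_card_erase_of_mem]
    · ring
    · simp only [divF, Finset.mem_filter, mem_ballF]; simp; positivity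

/-- Visible points of the ball. -/
noncomputable def visF (ρ : ℝ) : Finset (ℤ × ℤ) :=
  (ballF ρ).filter (fun y => Int.gcd y.1 y.2 = 1)

lemma visF_card (ρ : ℝ) : ((visF ρ).card : ℝ) =
    ∑' d : ℕ, ((ArithmeticFunction.moebius d : ℤ) : ℝ) * (((divF ρ d 0).erase 0).card : ℝ) := by
  have h1 : ((visF ρ).card : ℝ) = ∑ y ∈ (ballF ρ).erase 0,
      ∑ d ∈ (Int.gcd y.1 y.2).divisors, ((ArithmeticFunction.moebius d : ℤ) : ℝ) := by
    simp_rw [moebius_sum_div]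
    rw [Finset.sum_boole]
    congr 2
    ext y
    simp only [visF, Finset.mem_filter, Finset.mem_erase]
    constructor
    · rintro ⟨h1, h2⟩
      refine ⟨⟨?_, h1⟩, h2⟩
      rintro rfl
      simp at h2
    · tauto
  set S := ((ballF ρ).erase 0).biUnion (fun y => (Int.gcd y.1 y.2).divisors) with hS
  have hg : ∀ y ∈ (ballF ρ).erase 0, Int.gcd y.1 y.2 ≠ 0 := by
    intro y hy h
    rw [Int.gcd_eq_zero_iff] at h
    exact (Finset.mem_erase.mp hy).1 (Prod.ext h.1 h.2)
  have hmem : ∀ d y, y ∈ (divF ρ d 0).erase 0 ↔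
      y ∈ (ballF ρ).erase 0 ∧ d ∈ (Int.gcd y.1 y.2).divisors := by
    intro d y
    have : d ∣ Int.gcd y.1 y.2 ↔ (d : ℤ) ∣ y.1 ∧ (d : ℤ) ∣ y.2 := Int.dvd_gcd_iff
    constructor
    · intro h
      simp only [divF, Finset.mem_erase, Finset.mem_filter, Prod.fst_zero, Prod.snd_zero,
        add_zero] at h
      have h' : y ∈ (ballF ρ).erase 0 := Finset.mem_erase.mpr ⟨h.1, h.2.1⟩
      exact ⟨h', Nat.mem_divisors.mpr ⟨this.mpr h.2.2, hg y h'⟩⟩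
    · rintro ⟨h, h'⟩
      have := this.mp (Nat.mem_divisors.mp h').1
      simp only [divF, Finset.mem_erase, Finset.mem_filter, Prod.fst_zero, Prod.snd_zero,
        add_zero] at h ⊢
      tauto
  rw [tsum_eq_sum (s := S), h1]
  · have h2 : ∀ d ∈ S, ((ArithmeticFunction.moebius d : ℤ) : ℝ) *
        (((divF ρ d 0).erase 0).card : ℝ) =
        ∑ y ∈ (divF ρ d 0).erase 0, ((ArithmeticFunction.moebius d : ℤ) : ℝ) := by
      intro d _
      rw [Finset.sum_const, nsmul_eq_mul, mul_comm]
    rw [Finset.sum_congr rfl h2]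
    refine Finset.sum_comm' ?_
    intro y d
    rw [hmem]
    constructor
    · intro h
      exact ⟨h, Finset.mem_biUnion.mpr ⟨y, h.1, h.2⟩⟩
    · tauto
  · intro d hd
    have : (divF ρ d 0).erase 0 = ∅ := by
      rw [Finset.eq_empty_iff_forall_notMem]
      intro y hy
      rw [hmem] at hy
      exact hd (Finset.mem_biUnion.mpr ⟨y, hy.1, hy.2⟩)
    rw [this]; simp

lemma visF_tendsto :
    Tendsto (fun ρ : ℝ => ((visF ρ).card : ℝ) / (Real.pi * ρ ^ 2)) atTop
      (𝓝 (6 / Real.pi ^ 2)) := by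
  rw [← tsum_moebius]
  have hpi := Real.pi_pos
  have h := tendsto_tsum_of_dominated_convergence (𝓕 := (atTop : Filter ℝ))
    (f := fun (ρ : ℝ) (d : ℕ) => ((ArithmeticFunction.moebius d : ℤ) : ℝ) *
      (((divF ρ d 0).erase 0).card : ℝ) / (Real.pi * ρ ^ 2))
    (g := fun d : ℕ => ((ArithmeticFunction.moebius d : ℤ) : ℝ) / (d : ℝ) ^ 2)
    (bound := fun d : ℕ => 9 / Real.pi * (1 / (d : ℝ) ^ 2))
    ((Real.summable_one_div_nat_pow.mpr one_lt_two).mul_left _) ?_ ?_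
  · refine h.congr fun ρ => ?_
    rw [visF_card, tsum_div_const]
  · intro d
    have h1 := (divF_zero_erase_tendsto d).const_mul
      (((ArithmeticFunction.moebius d : ℤ) : ℝ) / Real.pi)
    convert h1 using 2
    · ring
    · field_simp
  · filter_upwards [eventually_gt_atTop 0] with ρ hρ d
    rw [Real.norm_eq_abs, abs_div, abs_mul, abs_of_pos (show 0 < Real.pi * ρ ^ 2 by positivity),
      div_le_iff₀ (by positivity), Nat.abs_cast]
    calc _ ≤ 1 * (9 * ρ ^ 2 / d ^ 2) := by
          gcongr
          · exact abs_moebius_real_le d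
          · exact divF_zero_erase_le hρ.le d
      _ = _ := by field_simp

lemma crt_int (Q : Finset ℕ) (hQ : ∀ p ∈ Q, p.Prime) (a : ℕ → ℤ) (N : ℕ) :
    ∃ t : ℤ, (N : ℤ) ≤ t ∧ ∀ p ∈ Q, (p : ℤ) ∣ t - a p := by
  obtain ⟨k, hk⟩ := Nat.chineseRemainderOfFinset (fun p => (a p % (p : ℤ)).toNat) (fun p => p) Q
    (fun p hp => (hQ p hp).ne_zero) (by
      intro p hp q hq hpq
      exact (Nat.coprime_primes (hQ p hp) (hQ q hq)).mpr hpq)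
  have hprod : 1 ≤ ∏ p ∈ Q, p := Finset.one_le_prod' fun p hp => (hQ p hp).one_le
  refine ⟨k + N * ((∏ p ∈ Q, p : ℕ) : ℤ), ?_, ?_⟩
  · have : N * 1 ≤ N * ∏ p ∈ Q, p := Nat.mul_le_mul_left _ hprod
    have h2 : (N : ℤ) ≤ N * ((∏ p ∈ Q, p : ℕ) : ℤ) := by
      have : N ≤ N * ∏ p ∈ Q, p := by omega
      exact_mod_cast this
    omega
  · intro p hp
    have h1 := hk p hp
    have hp0 : (p : ℤ) ≠ 0 := by exact_mod_cast (hQ p hp).ne_zero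
    have h2 : ((k : ℕ) : ℤ) ≡ (((a p % (p : ℤ)).toNat : ℕ) : ℤ) [ZMOD p] :=
      (Int.natCast_modEq_iff).mpr h1
    rw [Int.toNat_of_nonneg (Int.emod_nonneg _ hp0)] at h2
    have h3 : (p : ℤ) ∣ k - a p := by
      have := (h2.trans (Int.mod_modEq _ _)).symm
      exact Int.modEq_iff_dvd.mp this
    have h4 : (p : ℤ) ∣ ((∏ p ∈ Q, p : ℕ) : ℤ) := by
      exact_mod_cast Finset.dvd_prod_of_mem (fun p => p) hp
    have h5 : (k : ℤ) + N * ((∏ p ∈ Q, p : ℕ) : ℤ) - a p =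
      (k - a p) + N * ((∏ p ∈ Q, p : ℕ) : ℤ) := by ring
    rw [h5]
    exact dvd_add h3 (Dvd.dvd.mul_left h4 _)

lemma exists_shift (ρ : ℝ) (S : Finset (ℤ × ℤ)) (hS : S ⊆ visF ρ) :
    ∃ t : ℤ × ℤ, ∀ y ∈ visF ρ, (y + t ∈ Vis ↔ y ∉ S) := by
  classical
  obtain ⟨R, hR⟩ : ∃ R : ℕ, ∀ y ∈ visF ρ, |y.1| < R ∧ |y.2| < R := by
    refine ⟨⌈|ρ|⌉₊ + 1, fun y hy => ?_⟩
    have hy' := mem_ballF.mp (Finset.mem_filter.mp hy).1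
    have key : ∀ a : ℤ, (a : ℝ)^2 < ρ^2 → |a| < ((⌈|ρ|⌉₊ + 1 : ℕ) : ℤ) := by
      intro a ha
      have h1 : |(a : ℝ)| < |ρ| := sq_lt_sq.mp ha
      have h2 := Nat.le_ceil |ρ|
      have h3 : ((|a| : ℤ) : ℝ) < ((⌈|ρ|⌉₊ + 1 : ℕ) : ℝ) := by push_cast; linarith
      exact_mod_cast h3
    exact ⟨key _ (by nlinarith [sq_nonneg (y.2 : ℝ)]), key _ (by nlinarith [sq_nonneg (y.1 : ℝ)])⟩
  set P := 2 * R with hP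
  let q : ℤ × ℤ → ℕ := fun y => Nat.nth Nat.Prime (P + Encodable.encode y)
  have hqp : ∀ y, (q y).Prime := fun y => Nat.prime_nth_prime _
  have hqP : ∀ y, P < q y := fun y => by
    have := Nat.add_two_le_nth_prime (P + Encodable.encode y)
    show P < Nat.nth Nat.Prime (P + Encodable.encode y)
    omega
  have hqi : Function.Injective q := by
    intro y z h
    have := Nat.nth_injective Nat.infinite_setOfPred_prime h
    exact Encodable.encode_injective (by omega)
  let Q1 : Finset ℕ := (Finset.range (P + 1)).filter Nat.Prime ∪ S.image q
  have hQ1 : ∀ p ∈ Q1, p.Prime := by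
    intro p hp
    rcases Finset.mem_union.mp hp with h | h
    · exact (Finset.mem_filter.mp h).2
    · obtain ⟨y, _, rfl⟩ := Finset.mem_image.mp h
      exact hqp y
  obtain ⟨t1, ht1R, ht1⟩ := crt_int Q1 hQ1
    (fun p => if p ≤ P then 0 else -(Function.invFun q p).1) R
  let Q2 : Finset ℕ := (Finset.range ((t1 + R).toNat + 1)).filter Nat.Prime ∪ Q1
  have hQ2 : ∀ p ∈ Q2, p.Prime := by
    intro p hp
    rcases Finset.mem_union.mp hp with h | h
    · exact (Finset.mem_filter.mp h).2
    · exact hQ1 p h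
  obtain ⟨t2, _, ht2⟩ := crt_int Q2 hQ2
    (fun p => if p ≤ P then 0 else if p ∈ S.image q then -(Function.invFun q p).2 else R) 0
  have hinv : ∀ y, Function.invFun q (q y) = y := Function.leftInverse_invFun hqi
  have hq1 : ∀ z ∈ S, (q z : ℤ) ∣ t1 + z.1 := by
    intro z hz
    have h := ht1 (q z) (Finset.mem_union_right _ (Finset.mem_image_of_mem q hz))
    simp only [not_le.mpr (hqP z), if_false, hinv] at h
    simpa using h
  have hq2 : ∀ z ∈ S, (q z : ℤ) ∣ t2 + z.2 := by
    intro z hz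
    have hm := Finset.mem_image_of_mem q hz
    have h := ht2 (q z) (Finset.mem_union_right _ (Finset.mem_union_right _ hm))
    simp only [not_le.mpr (hqP z), if_false, hinv, hm, if_true] at h
    simpa using h
  refine ⟨(t1, t2), fun y hy => ?_⟩
  obtain ⟨hy1, hy2⟩ := hR y hy
  show Int.gcd (y.1 + t1) (y.2 + t2) = 1 ↔ y ∉ S
  constructor
  · intro hg hyS
    have h1 := hq1 y hyS
    have h2 := hq2 y hyS
    rw [add_comm] at h1 h2
    have h3 : q y ∣ Int.gcd (y.1 + t1) (y.2 + t2) := Int.dvd_gcd_iff.mpr ⟨h1, h2⟩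
    rw [hg] at h3
    exact (hqp y).one_lt.ne' (Nat.dvd_one.mp h3)
  · intro hyS
    by_contra hg
    obtain ⟨p, hp, hpd⟩ := Nat.exists_prime_and_dvd hg
    obtain ⟨hp1, hp2⟩ := Int.dvd_gcd_iff.mp hpd
    rw [abs_lt] at hy1 hy2
    have hple : (p : ℤ) ≤ y.1 + t1 := Int.le_of_dvd (by omega) hp1
    have hpQ2 : p ∈ Q2 := by
      refine Finset.mem_union_left _ (Finset.mem_filter.mpr ⟨Finset.mem_range.mpr ?_, hp⟩)
      omega
    have h2 := ht2 p hpQ2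
    by_cases hpP : p ≤ P
    · have h1 := ht1 p (Finset.mem_union_left _ (Finset.mem_filter.mpr
        ⟨Finset.mem_range.mpr (by omega), hp⟩))
      simp only [hpP, if_true, sub_zero] at h1 h2
      have h3 : p ∣ Int.gcd y.1 y.2 :=
        Int.dvd_gcd_iff.mpr ⟨(Int.dvd_add_left h1).mp hp1, (Int.dvd_add_left h2).mp hp2⟩
      rw [(Finset.mem_filter.mp hy).2] at h3
      exact hp.one_lt.ne' (Nat.dvd_one.mp h3)
    · by_cases hpS : p ∈ S.image q
      · obtain ⟨z, hz, rfl⟩ := Finset.mem_image.mp hpS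
        obtain ⟨hz1, hz2⟩ := hR z (hS hz)
        rw [abs_lt] at hz1 hz2
        have e1 : y.1 - z.1 = 0 := by
          refine Int.eq_zero_of_abs_lt_dvd (m := (q z : ℤ)) ?_ ?_
          · have e : y.1 - z.1 = (y.1 + t1) - (t1 + z.1) := by ring
            rw [e]
            exact dvd_sub hp1 (hq1 z hz)
          · rw [abs_lt]; constructor <;> omega
        have e2 : y.2 - z.2 = 0 := by
          refine Int.eq_zero_of_abs_lt_dvd (m := (q z : ℤ)) ?_ ?_
          · have e : y.2 - z.2 = (y.2 + t2) - (t2 + z.2) := by ring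
            rw [e]
            exact dvd_sub hp2 (hq2 z hz)
          · rw [abs_lt]; constructor <;> omega
        have : y = z := Prod.ext (by omega) (by omega)
        exact hyS (this ▸ hz)
      · simp only [hpP, if_false, hpS] at h2
        have h3 : (p : ℤ) ∣ y.2 + R := by
          have e : y.2 + (R : ℤ) = (y.2 + t2) - (t2 - R) := by ring
          rw [e]
          exact dvd_sub hp2 h2
        have := Int.le_of_dvd (by omega) h3
        omega

lemma patches_finite (ρ : ℝ) : (Set.range fun t : ℤ × ℤ =>
    {y : ℤ × ℤ | y + t ∈ Vis ∧ (y.1 : ℝ)^2 + (y.2 : ℝ)^2 < ρ^2}).Finite := by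
  refine (ballF ρ).finite_toSet.finite_subsets.subset ?_
  rintro _ ⟨t, rfl⟩ y hy
  exact Finset.mem_coe.mpr (mem_ballF.mpr hy.2)

lemma Npatch_ge (ρ : ℝ) : 2 ^ (visF ρ).card ≤ Npatch ρ := by
  classical
  have hex : ∀ S : (visF ρ).powerset, ∃ t : ℤ × ℤ, ∀ y ∈ visF ρ, (y + t ∈ Vis ↔ y ∉ S.1) :=
    fun S => exists_shift ρ S.1 (Finset.mem_powerset.mp S.2)
  choose τ hτ using hex
  have := (patches_finite ρ).to_subtype
  unfold Npatch
  rw [← Finset.card_powerset, ← Nat.card_eq_finsetCard]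
  refine Nat.card_le_card_of_injective (fun S => ⟨_, ⟨τ S, rfl⟩⟩) ?_
  intro S S' h
  replace h := congrArg Subtype.val h
  dsimp only at h
  have key : ∀ y ∈ visF ρ, (y ∉ S.1 ↔ y ∉ S'.1) := by
    intro y hy
    have hb := mem_ballF.mp (Finset.mem_filter.mp hy).1
    rw [← hτ S y hy, ← hτ S' y hy]
    have := Set.ext_iff.mp h y
    simp only [Set.mem_ofPred_eq, hb, and_true] at this
    exact this
  apply Subtype.ext
  ext y
  constructor
  · intro hy
    by_contra h'
    exact (key y (Finset.mem_powerset.mp S.2 hy)).mpr h' hy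
  · intro hy
    by_contra h'
    exact (key y (Finset.mem_powerset.mp S'.2 hy)).mp h' hy

/-- Points `y` of the ball such that `y + t` is not divisible by any prime factor of `M`. -/
noncomputable def copF (ρ : ℝ) (M : ℕ) (t : ℤ × ℤ) : Finset (ℤ × ℤ) :=
  (ballF ρ).filter (fun y => Nat.gcd (Int.gcd (y.1 + t.1) (y.2 + t.2)) M = 1)

/-- Truncated density. -/
noncomputable def cM (M : ℕ) : ℝ :=
  ∑ d ∈ M.divisors, ((ArithmeticFunction.moebius d : ℤ) : ℝ) / (d : ℝ) ^ 2

lemma copF_card (ρ : ℝ) {M : ℕ} (hM : M ≠ 0) (t : ℤ × ℤ) : ((copF ρ M t).card : ℝ) =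
    ∑ d ∈ M.divisors, ((ArithmeticFunction.moebius d : ℤ) : ℝ) * ((divF ρ d t).card : ℝ) := by
  have h1 : ((copF ρ M t).card : ℝ) = ∑ y ∈ ballF ρ,
      ∑ d ∈ (Nat.gcd (Int.gcd (y.1 + t.1) (y.2 + t.2)) M).divisors,
        ((ArithmeticFunction.moebius d : ℤ) : ℝ) := by
    simp_rw [moebius_sum_div]
    rw [Finset.sum_boole]
    rfl
  have h2 : ∀ d ∈ M.divisors, ((ArithmeticFunction.moebius d : ℤ) : ℝ) *
        ((divF ρ d t).card : ℝ) =
        ∑ y ∈ divF ρ d t, ((ArithmeticFunction.moebius d : ℤ) : ℝ) := by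
    intro d _
    rw [Finset.sum_const, nsmul_eq_mul, mul_comm]
  rw [Finset.sum_congr rfl h2, h1]
  refine Finset.sum_comm' ?_
  intro y d
  have : d ∣ Int.gcd (y.1 + t.1) (y.2 + t.2) ↔ (d : ℤ) ∣ y.1 + t.1 ∧ (d : ℤ) ∣ y.2 + t.2 :=
    Int.dvd_gcd_iff
  simp only [divF, Finset.mem_filter, Nat.mem_divisors, Nat.dvd_gcd_iff, this]
  have h0 : Nat.gcd (Int.gcd (y.1 + t.1) (y.2 + t.2)) M ≠ 0 := Nat.gcd_ne_zero_right hM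
  tauto

lemma copF_tendsto {M : ℕ} (hM : M ≠ 0) (t : ℤ × ℤ) :
    Tendsto (fun ρ : ℝ => ((copF ρ M t).card : ℝ) / (Real.pi * ρ ^ 2)) atTop (𝓝 (cM M)) := by
  have hpi := Real.pi_pos
  have h : Tendsto (fun ρ : ℝ => ∑ d ∈ M.divisors,
      ((ArithmeticFunction.moebius d : ℤ) : ℝ) / Real.pi * (((divF ρ d t).card : ℝ) / ρ ^ 2)) atTop
      (𝓝 (∑ d ∈ M.divisors,
        ((ArithmeticFunction.moebius d : ℤ) : ℝ) / Real.pi * (Real.pi / d ^ 2))) :=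
    tendsto_finsetSum _ fun d hd =>
      (divF_tendsto (Nat.pos_of_mem_divisors hd) t).const_mul _
  have e : cM M = ∑ d ∈ M.divisors,
        ((ArithmeticFunction.moebius d : ℤ) : ℝ) / Real.pi * (Real.pi / d ^ 2) := by
    refine Finset.sum_congr rfl fun d hd => ?_
    field_simp
  rw [e]
  refine h.congr fun ρ => ?_
  rw [copF_card ρ hM, Finset.sum_div]
  refine Finset.sum_congr rfl fun d hd => ?_
  ring

lemma cM_tendsto : Tendsto (fun K : ℕ => cM K.factorial) atTop (𝓝 (6 / Real.pi ^ 2)) := by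
  rw [← tsum_moebius]
  have h := tendsto_tsum_of_dominated_convergence (𝓕 := (atTop : Filter ℕ))
    (f := fun (K : ℕ) (d : ℕ) => if d ∈ K.factorial.divisors then
      ((ArithmeticFunction.moebius d : ℤ) : ℝ) / (d : ℝ) ^ 2 else 0)
    (g := fun d : ℕ => ((ArithmeticFunction.moebius d : ℤ) : ℝ) / (d : ℝ) ^ 2)
    (bound := fun d : ℕ => 1 / (d : ℝ) ^ 2)
    (Real.summable_one_div_nat_pow.mpr one_lt_two) ?_ ?_
  · refine h.congr fun K => ?_
    rw [tsum_eq_sum (s := K.factorial.divisors)]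
    · exact Finset.sum_congr rfl fun d hd => if_pos hd
    · intro d hd
      exact if_neg hd
  · intro d
    refine tendsto_const_nhds.congr' ?_
    filter_upwards [eventually_ge_atTop d] with K hK
    rcases Nat.eq_zero_or_pos d with rfl | hd
    · simp
    · rw [if_pos]
      exact Nat.mem_divisors.mpr ⟨Nat.dvd_factorial hd hK, Nat.factorial_ne_zero K⟩
  · refine Eventually.of_forall fun K d => ?_
    split_ifs
    · rw [Real.norm_eq_abs, abs_div, abs_of_nonneg (sq_nonneg (d : ℝ))]
      gcongr
      exact abs_moebius_real_le d
    · simp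

lemma Npatch_le (ρ : ℝ) {M : ℕ} (hM : M ≠ 0) :
    Npatch ρ ≤ ∑ t ∈ Finset.Ico (0 : ℤ) M ×ˢ Finset.Ico (0 : ℤ) M, 2 ^ (copF ρ M t).card := by
  classical
  set T := Finset.Ico (0 : ℤ) M ×ˢ Finset.Ico (0 : ℤ) M with hT
  let U : Finset (Finset (ℤ × ℤ)) := T.biUnion fun t => (copF ρ M t).powerset
  have hsub : (Set.range fun t : ℤ × ℤ =>
      {y : ℤ × ℤ | y + t ∈ Vis ∧ (y.1 : ℝ)^2 + (y.2 : ℝ)^2 < ρ^2}) ⊆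
      (fun s : Finset (ℤ × ℤ) => (s : Set (ℤ × ℤ))) '' (U : Set (Finset (ℤ × ℤ))) := by
    rintro _ ⟨t, rfl⟩
    refine ⟨(ballF ρ).filter (fun y => y + t ∈ Vis), ?_, ?_⟩
    · have hMz : (0 : ℤ) < M := by exact_mod_cast Nat.pos_of_ne_zero hM
      refine Finset.mem_coe.mpr (Finset.mem_biUnion.mpr ⟨(t.1 % M, t.2 % M), ?_, ?_⟩)
      · rw [hT, Finset.mem_product, Finset.mem_Ico, Finset.mem_Ico]
        exact ⟨⟨Int.emod_nonneg _ hMz.ne', Int.emod_lt_of_pos _ hMz⟩,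
          ⟨Int.emod_nonneg _ hMz.ne', Int.emod_lt_of_pos _ hMz⟩⟩
      · rw [Finset.mem_powerset]
        intro y hy
        rw [Finset.mem_filter] at hy
        refine Finset.mem_filter.mpr ⟨hy.1, ?_⟩
        set g := Nat.gcd (Int.gcd (y.1 + t.1 % M) (y.2 + t.2 % M)) M with hg
        have hgM : (g : ℤ) ∣ M := by exact_mod_cast Nat.gcd_dvd_right _ _
        obtain ⟨h1, h2⟩ := Int.dvd_gcd_iff.mp (hg ▸ Nat.gcd_dvd_left _ _ :
          g ∣ Int.gcd (y.1 + t.1 % M) (y.2 + t.2 % M))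
        have key : ∀ a b : ℤ, (g : ℤ) ∣ a + b % M → (g : ℤ) ∣ a + b := by
          intro a b h
          have : a + b = (a + b % M) + M * (b / M) := by
            have := Int.emod_add_mul_ediv b M
            linarith
          rw [this]
          exact dvd_add h (Dvd.dvd.mul_right hgM _)
        have h3 : g ∣ Int.gcd (y.1 + t.1) (y.2 + t.2) :=
          Int.dvd_gcd_iff.mpr ⟨key _ _ h1, key _ _ h2⟩
        have h4 : Int.gcd (y.1 + t.1) (y.2 + t.2) = 1 := hy.2
        rw [h4] at h3
        exact Nat.dvd_one.mp h3
    · ext y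
      simp only [Finset.coe_filter, Set.mem_ofPred_eq, mem_ballF]
      tauto
  calc Npatch ρ ≤ ((fun s : Finset (ℤ × ℤ) => (s : Set (ℤ × ℤ))) ''
        (U : Set (Finset (ℤ × ℤ)))).ncard :=
        Set.ncard_le_ncard hsub (U.finite_toSet.image _)
    _ ≤ (U : Set (Finset (ℤ × ℤ))).ncard := Set.ncard_image_le U.finite_toSet
    _ = U.card := Set.ncard_coe_finset U
    _ ≤ ∑ t ∈ T, ((copF ρ M t).powerset).card := Finset.card_biUnion_le
    _ = _ := by simp only [Finset.card_powerset]

lemma log_Npatch_le {M : ℕ} (hM : M ≠ 0) {c : ℝ} (hc : cM M < c) :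
    ∀ᶠ ρ : ℝ in atTop, Real.log (Npatch ρ) / (Real.pi * ρ ^ 2) ≤ c * Real.log 2 := by
  obtain ⟨c', hc1, hc2⟩ := exists_between hc
  have hpi := Real.pi_pos
  have hl2 : 0 < Real.log 2 := Real.log_pos one_lt_two
  have h1 : ∀ᶠ ρ : ℝ in atTop, ∀ t ∈ Finset.Ico (0 : ℤ) M ×ˢ Finset.Ico (0 : ℤ) M,
      ((copF ρ M t).card : ℝ) / (Real.pi * ρ ^ 2) < c' := by
    rw [Filter.eventually_all_finset]
    intro t _
    exact (copF_tendsto hM t).eventually (gt_mem_nhds hc1)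
  have h2 : Tendsto (fun ρ : ℝ => Real.log (M * M) / (Real.pi * ρ ^ 2)) atTop (𝓝 0) :=
    tendsto_const_nhds.div_atTop ((tendsto_pow_atTop two_ne_zero).const_mul_atTop hpi)
  have h3 : 0 < (c - c') * Real.log 2 := mul_pos (by linarith) hl2
  filter_upwards [h1, h2.eventually (gt_mem_nhds h3), eventually_gt_atTop 0] with ρ h1 h2 hρ
  have hD : 0 < Real.pi * ρ ^ 2 := by positivity
  have hM' : (0 : ℝ) < M := by exact_mod_cast Nat.pos_of_ne_zero hM
  have hN : (Npatch ρ : ℝ) ≤ (M * M) * (2 : ℝ) ^ (c' * (Real.pi * ρ ^ 2)) := by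
    have hle : (Npatch ρ : ℝ) ≤ ∑ t ∈ Finset.Ico (0 : ℤ) M ×ˢ Finset.Ico (0 : ℤ) M,
        (2 : ℝ) ^ (copF ρ M t).card := by exact_mod_cast Npatch_le ρ hM
    refine hle.trans ?_
    have : ∑ t ∈ Finset.Ico (0 : ℤ) M ×ˢ Finset.Ico (0 : ℤ) M, (2 : ℝ) ^ (copF ρ M t).card ≤
        ∑ t ∈ Finset.Ico (0 : ℤ) M ×ˢ Finset.Ico (0 : ℤ) M,
          (2 : ℝ) ^ (c' * (Real.pi * ρ ^ 2)) := by
      refine Finset.sum_le_sum fun t ht => ?_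
      rw [← Real.rpow_natCast]
      refine Real.rpow_le_rpow_of_exponent_le one_le_two ?_
      exact ((div_lt_iff₀ hD).mp (h1 t ht)).le
    refine this.trans (le_of_eq ?_)
    rw [Finset.sum_const, Finset.card_product, Int.card_Ico, nsmul_eq_mul]
    simp
  have hNpos : (0 : ℝ) < Npatch ρ := by
    have : 0 < Npatch ρ := lt_of_lt_of_le (by positivity) (Npatch_ge ρ)
    exact_mod_cast this
  have hlog := Real.log_le_log hNpos hN
  rw [Real.log_mul (by positivity) (by positivity), Real.log_rpow two_pos] at hlog
  rw [div_lt_iff₀ hD] at h2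
  rw [div_le_iff₀ hD]
  linarith

/-- The patch counting entropy of the visible points equals `(6/π²)·log 2`. -/
theorem visible_patch_counting_entropy :
    Tendsto (fun ρ : ℝ => Real.log (Npatch ρ) / (Real.pi * ρ^2)) atTop
      (𝓝 (6 / Real.pi^2 * Real.log 2)) := by
  have hpi := Real.pi_pos
  have hl2 : 0 < Real.log 2 := Real.log_pos one_lt_two
  rw [tendsto_order]
  constructor
  · intro a ha
    have h := (visF_tendsto.mul_const (Real.log 2)).eventually (lt_mem_nhds ha)
    filter_upwards [h, eventually_gt_atTop 0] with ρ h hρ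
    refine lt_of_lt_of_le h ?_
    have hD : 0 < Real.pi * ρ ^ 2 := by positivity
    rw [div_mul_eq_mul_div]
    refine div_le_div_of_nonneg_right ?_ hD.le
    rw [← Real.log_pow]
    refine Real.log_le_log (by positivity) ?_
    exact_mod_cast Npatch_ge ρ
  · intro b hb
    have hb' : 6 / Real.pi ^ 2 < b / Real.log 2 := by rwa [lt_div_iff₀ hl2]
    obtain ⟨c, hc1, hc2⟩ := exists_between hb'
    obtain ⟨K, hK⟩ := (cM_tendsto.eventually (gt_mem_nhds hc1)).exists
    filter_upwards [log_Npatch_le (Nat.factorial_ne_zero K) hK] with ρ h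
    refine lt_of_le_of_lt h ?_
    rwa [← lt_div_iff₀ hl2]
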